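/- arXiv:2401.06934 — 6 statements merged into one kernel-verified Lean document; each statement's English description precedes it below -/
import Mathlib

section
/- Let β > 0 and γ > 0, and let ω : ℝ → ℝ be a continuous function such that ω(s)/s → 0 as s → -∞. Define z : ℝ → ℝ by z(t) = γ ω(t) - β γ ∫_{-∞}^{0} e^{β s} ω(t+s) ds (the improper integral converges absolutely under the growth assumption). Then z is continuous and is a pathwise solution of the Langevin equation in integral form: for every t ∈ ℝ, z(t) - z(0) = -β ∫_{0}^{t} z(s) ds + γ (ω(t) - ω(0)). -/
open MeasureTheory intervalIntegral Filter

lemma ou_aux_integrable (β : ℝ) (hβ : 0 < β) (ω : ℝ → ℝ) (hω : Continuous ω)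
    (hgrowth : Tendsto (fun s => ω s / s) atBot (nhds 0)) (a : ℝ) :
    IntegrableOn (fun u => Real.exp (β * u) * ω u) (Set.Iic a) := by
  have h1 : IntegrableOn (fun x => Real.exp (β * (-x)) * ω (-x)) (Set.Ioi (-a)) := by
    refine integrable_of_isBigO_exp_neg (b := β / 2) (by positivity) (by fun_prop) ?_
    have hb : (fun x : ℝ => ω (-x)) =O[atTop] (fun x : ℝ => x ^ 1) := by
      refine Asymptotics.IsBigO.of_bound 1 ?_
      have h2 := hgrowth.comp tendsto_neg_atTop_atBot
      have h3 := h2.eventually (Metric.ball_mem_nhds 0 one_pos)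
      filter_upwards [h3, eventually_gt_atTop 0] with x hx hx0
      simp only [Function.comp, dist_zero_right, norm_div, norm_neg] at hx
      rw [div_lt_one (norm_pos_iff.2 hx0.ne')] at hx
      simpa using hx.le
    have hc := hb.trans (isLittleO_pow_exp_pos_mul_atTop 1 (b := β / 2) (by positivity)).isBigO
    have hd := (Asymptotics.isBigO_refl (fun x : ℝ => Real.exp (β * (-x))) atTop).mul hc
    refine hd.congr_right fun x => ?_
    rw [← Real.exp_add]
    congr 1
    ring
  have h2 := h1.comp_neg
  rw [integrableOn_Iic_iff_integrableOn_Iio]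
  simpa using h2

lemma ou_aux_shift (β : ℝ) (ω : ℝ → ℝ) (t : ℝ) :
    (fun s => Real.exp (β * s) * ω (t + s)) =
      fun s => Real.exp (-(β * t)) * (Real.exp (β * (s + t)) * ω (s + t)) := by
  funext s
  rw [← mul_assoc, ← Real.exp_add, add_comm t s]
  congr 2
  ring

theorem ou_solves_langevin (β γ : ℝ) (hβ : 0 < β) (hγ : 0 < γ)
    (ω : ℝ → ℝ) (hω : Continuous ω)
    (hgrowth : Tendsto (fun s => ω s / s) atBot (nhds 0))
    (z : ℝ → ℝ)
    (hz : z = fun t => γ * ω t - β * γ * ∫ s in Set.Iic (0 : ℝ), Real.exp (β * s) * ω (t + s)) :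
    (∀ t : ℝ, IntegrableOn (fun s => Real.exp (β * s) * ω (t + s)) (Set.Iic (0 : ℝ))) ∧
    Continuous z ∧
    ∀ t : ℝ, z t - z 0 = -β * (∫ s in (0 : ℝ)..t, z s) + γ * (ω t - ω 0) := by
  have hI := ou_aux_integrable β hβ ω hω hgrowth
  set g : ℝ → ℝ := fun u => Real.exp (β * u) * ω u with hg
  have hgc : Continuous g := by fun_prop
  have hpre : ∀ t : ℝ, (fun s : ℝ => s + t) ⁻¹' Set.Iic t = Set.Iic 0 := by
    intro t; ext s; simp
  have hmp : ∀ t : ℝ, MeasurePreserving (fun s : ℝ => s + t) volume volume :=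
    fun t => measurePreserving_add_right volume t
  have hme : ∀ t : ℝ, MeasurableEmbedding (fun s : ℝ => s + t) :=
    fun t => measurableEmbedding_addRight t
  set J : ℝ → ℝ := fun t => ∫ s in Set.Iic (0 : ℝ), Real.exp (β * s) * ω (t + s) with hJ
  have hJeq : ∀ t, J t = Real.exp (-(β * t)) * ((∫ u in Set.Iic 0, g u) + ∫ u in (0:ℝ)..t, g u) := by
    intro t
    have e1 := (hmp t).setIntegral_preimage_emb (hme t) g (Set.Iic t)
    rw [hpre] at e1
    have e2 := integral_Iic_sub_Iic (hI 0) (hI t)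
    simp only [hJ]
    rw [ou_aux_shift, MeasureTheory.integral_const_mul]
    congr 1
    rw [← e2, add_sub_cancel, ← e1]
  have hJd : ∀ t, HasDerivAt J (ω t - β * J t) t := by
    intro t
    have d1 : HasDerivAt (fun t => ∫ u in (0:ℝ)..t, g u) (g t) t :=
      integral_hasDerivAt_right (hgc.intervalIntegrable _ _)
        (hgc.stronglyMeasurableAtFilter _ _) hgc.continuousAt
    have d2 : HasDerivAt (fun t => Real.exp (-(β * t))) (Real.exp (-(β * t)) * (-(β * 1))) t :=
      (((hasDerivAt_id t).const_mul β).neg).exp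
    have d3 := d2.mul (d1.const_add (∫ u in Set.Iic 0, g u))
    have hf : J = fun t => Real.exp (-(β * t)) * ((∫ u in Set.Iic 0, g u) + ∫ u in (0:ℝ)..t, g u) :=
      funext hJeq
    have hexp : Real.exp (-(β * t)) * Real.exp (β * t) = 1 := by
      rw [← Real.exp_add]; simp
    rw [hJeq t, hf]
    refine d3.congr_deriv ?_
    have hgt : g t = Real.exp (β * t) * ω t := rfl
    rw [hgt]
    linear_combination (ω t) * hexp
  have hJc : Continuous J := continuous_iff_continuousAt.2 fun t => (hJd t).continuousAt
  have hz' : z = fun t => γ * (ω t - β * J t) := by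
    rw [hz]; funext t; simp only [hJ]; ring
  refine ⟨fun t => ?_, ?_, fun t => ?_⟩
  · rw [ou_aux_shift]
    have := ((hmp t).integrableOn_comp_preimage (hme t) (f := g) (s := Set.Iic t)).2 (hI t)
    rw [hpre] at this
    exact this.const_mul _
  · rw [hz']; fun_prop
  · have e := integral_eq_sub_of_hasDerivAt (a := 0) (b := t) (fun x _ => hJd x)
      (Continuous.intervalIntegrable (by fun_prop) _ _)
    rw [hz', intervalIntegral.integral_const_mul, e]
    ring
end

section
/- Let g : [0, ∞) → ℝ be continuous with a̲ ≤ g(t) ≤ ā for all t ≥ 0, where 0 < a̲ ≤ ā. Let x : [0, ∞) → ℝ be differentiable with x'(t) = x(t)(g(t) - x(t)) for all t ≥ 0. If x(0) ∈ [a̲, ā], then x(t) ∈ [a̲, ā] for all t ≥ 0; that is, the interval [a̲, ā] is positively invariant for the equation. -/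
/-- The interval `[a̲, ā]` is positively invariant for the logistic equation
`x' = x (g(t) - x)` when `g(t) ∈ [a̲, ā]` with `0 < a̲ ≤ ā`. -/
theorem logistic_interval_invariant (g : ℝ → ℝ) (hg : ContinuousOn g (Set.Ici (0 : ℝ)))
    (aLow aUp : ℝ) (haLow : 0 < aLow) (ha : aLow ≤ aUp)
    (hbounds : ∀ t ∈ Set.Ici (0 : ℝ), aLow ≤ g t ∧ g t ≤ aUp)
    (x : ℝ → ℝ)
    (hx : ∀ t ∈ Set.Ici (0 : ℝ),
      HasDerivWithinAt x (x t * (g t - x t)) (Set.Ici (0 : ℝ)) t)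
    (hx0 : x 0 ∈ Set.Icc aLow aUp) :
    ∀ t ∈ Set.Ici (0 : ℝ), x t ∈ Set.Icc aLow aUp := by
  intro t ht
  have hc : ContinuousOn x (Set.Icc 0 t) := fun s hs =>
    (hx s hs.1).continuousWithinAt.mono Set.Icc_subset_Ici_self
  have hd : ∀ s ∈ Set.Ico 0 t,
      HasDerivWithinAt x (x s * (g s - x s)) (Set.Ici s) s := fun s hs =>
    (hx s hs.1).mono (Set.Ici_subset_Ici.2 hs.1)
  have htt : t ∈ Set.Icc 0 t := ⟨ht, le_refl t⟩
  constructor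
  · by_contra! hlt
    obtain ⟨c, hc1, hc2⟩ := exists_between (max_lt hlt haLow)
    have hcx := (le_max_left _ _).trans_lt hc1
    have hc0 := (le_max_right _ _).trans_lt hc1
    have h := image_le_of_deriv_right_lt_deriv_boundary (f := fun s => -x s)
      (f' := fun s => -(x s * (g s - x s))) (B := fun _ => -c) (B' := fun _ => 0)
      hc.neg (fun s hs => (hd s hs).fun_neg) (by linarith [hx0.1])
      (fun s => hasDerivAt_const s _) (fun s hs he => by
        have he' : x s = c := by linarith
        have hb := (hbounds s hs.1).1
        rw [he']
        have : 0 < c * (g s - c) := mul_pos hc0 (by linarith)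
        linarith) htt
    linarith
  · by_contra! hlt
    obtain ⟨c, hc1, hc2⟩ := exists_between hlt
    have h := image_le_of_deriv_right_lt_deriv_boundary (f := x)
      (B := fun _ => c) (B' := fun _ => 0)
      hc hd (by linarith [hx0.2])
      (fun s => hasDerivAt_const s _) (fun s hs he => by
        have hb := (hbounds s hs.1).2
        rw [he]
        exact mul_neg_of_pos_of_neg (by linarith) (by linarith)) htt
    linarith
end

section
/- Let g : [0, ∞) → ℝ be continuous with a̲ ≤ g(t) ≤ ā for all t ≥ 0, where 0 < a̲ ≤ ā. Let x : [0, ∞) → ℝ be differentiable with x(0) = x₀ > 0 and x'(t) = x(t)(g(t) - x(t)) for all t ≥ 0. Then for every ε > 0 there exists T > 0 (depending on ε and x₀) such that a̲ - ε ≤ x(t) ≤ ā + ε for all t ≥ T. Consequently, for every ε > 0, the interval B_ε = [a̲ - ε, ā + ε] is an absorbing set for the solutions of this equation. -/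
open Set Filter Topology in
theorem logistic_pos_aux (g x : ℝ → ℝ) (hg : ContinuousOn g (Set.Ici (0 : ℝ))) (h0 : 0 < x 0)
    (hx : ∀ t ∈ Set.Ici (0 : ℝ),
      HasDerivWithinAt x (x t * (g t - x t)) (Set.Ici (0 : ℝ)) t) :
    ∀ t, 0 ≤ t → 0 < x t := by
  have hxc : ContinuousOn x (Ici 0) := fun t ht => (hx t ht).continuousWithinAt
  let K : ℝ → ℝ := fun t => g (max 0 t) - x (max 0 t)
  have hK : Continuous K := by
    have hm : Continuous (fun t : ℝ => max 0 t) := by fun_prop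
    exact (hg.comp_continuous hm (fun t => mem_Ici.2 (le_max_left _ _))).sub
      (hxc.comp_continuous hm (fun t => mem_Ici.2 (le_max_left _ _)))
  let H : ℝ → ℝ := fun t => ∫ s in (0 : ℝ)..t, K s
  have hH : ∀ t, HasDerivAt H (K t) t := fun t => hK.integral_hasStrictDerivAt 0 t |>.hasDerivAt
  have hd : ∀ t ∈ Ici (0 : ℝ),
      HasDerivWithinAt (fun t => x t * Real.exp (-H t)) 0 (Ici 0) t := by
    intro t ht
    have h := (hx t ht).mul ((hH t).neg.exp.hasDerivWithinAt (s := Ici 0))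
    refine HasDerivWithinAt.congr_deriv h ?_
    have : K t = g t - x t := by simp only [K, max_eq_right (mem_Ici.1 ht)]
    rw [this]; simp only [Pi.neg_apply]; ring
  have hmono : MonotoneOn (fun t => x t * Real.exp (-H t)) (Ici 0) := by
    refine monotoneOn_of_hasDerivWithinAt_nonneg (f' := fun _ => 0) (convex_Ici 0)
      (fun t ht => (hd t ht).continuousWithinAt) ?_ (fun _ _ => le_rfl)
    intro t ht
    exact (hd t (interior_subset ht)).mono interior_subset
  intro t ht
  have h := hmono (mem_Ici.2 le_rfl) (mem_Ici.2 ht) ht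
  have h1 : 0 < x 0 * Real.exp (-H 0) := by positivity
  exact pos_of_mul_pos_left (h1.trans_le h) (Real.exp_pos _).le

theorem logistic_deriv_aux (g x : ℝ → ℝ) (c : ℝ) (hc : c ≠ 0) (t : ℝ) (hp : 0 < x t)
    (hx : HasDerivWithinAt x (x t * (g t - x t)) (Set.Ici (0 : ℝ)) t) :
    HasDerivWithinAt (fun t => ((x t)⁻¹ - c⁻¹) * Real.exp (c * t))
      (Real.exp (c * t) * (c - g t) / x t) (Set.Ici 0) t := by
  have he : HasDerivAt (fun t => Real.exp (c * t)) (Real.exp (c * t) * (c * 1)) t :=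
    ((hasDerivAt_id t).const_mul c).exp
  have h := ((hx.fun_inv hp.ne').sub_const c⁻¹).mul (he.hasDerivWithinAt (s := Set.Ici 0))
  refine HasDerivWithinAt.congr_deriv h ?_
  have := hp.ne'
  field_simp
  ring

theorem logistic_tendsto_aux (c C : ℝ) (hc : 0 < c) :
    Filter.Tendsto (fun t => c⁻¹ + C * Real.exp (-(c * t))) Filter.atTop (nhds c⁻¹) := by
  have h : Filter.Tendsto (fun t : ℝ => Real.exp (-(c * t))) Filter.atTop (nhds 0) :=
    Real.tendsto_exp_neg_atTop_nhds_zero.comp (Filter.tendsto_id.const_mul_atTop hc)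
  simpa using (h.const_mul C).const_add c⁻¹

/-- For the logistic equation `x' = x (g(t) - x)` with `g(t) ∈ [a̲, ā]`, `0 < a̲ ≤ ā`, every
solution with positive initial value eventually enters and remains in `[a̲ - ε, ā + ε]`:
the set `B_ε = [a̲ - ε, ā + ε]` is absorbing. -/
theorem logistic_absorbing_set (g : ℝ → ℝ) (hg : ContinuousOn g (Set.Ici (0 : ℝ)))
    (aLow aUp : ℝ) (haLow : 0 < aLow) (ha : aLow ≤ aUp)
    (hbounds : ∀ t ∈ Set.Ici (0 : ℝ), aLow ≤ g t ∧ g t ≤ aUp)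
    (x₀ : ℝ) (hx₀ : 0 < x₀) (x : ℝ → ℝ) (hx0 : x 0 = x₀)
    (hx : ∀ t ∈ Set.Ici (0 : ℝ),
      HasDerivWithinAt x (x t * (g t - x t)) (Set.Ici (0 : ℝ)) t) :
    ∀ ε > (0 : ℝ), ∃ T > (0 : ℝ), ∀ t ≥ T, x t ∈ Set.Icc (aLow - ε) (aUp + ε) := by
  have hpos := logistic_pos_aux g x hg (by rw [hx0]; exact hx₀) hx
  have haUp : 0 < aUp := haLow.trans_le ha
  have d1 := fun t (ht : t ∈ Set.Ici (0 : ℝ)) =>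
    logistic_deriv_aux g x aLow haLow.ne' t (hpos t ht) (hx t ht)
  have d2 := fun t (ht : t ∈ Set.Ici (0 : ℝ)) =>
    logistic_deriv_aux g x aUp haUp.ne' t (hpos t ht) (hx t ht)
  have m1 := antitoneOn_of_hasDerivWithinAt_nonpos (convex_Ici (0 : ℝ))
    (fun t ht => (d1 t ht).continuousWithinAt)
    (fun t ht => (d1 t (interior_subset ht)).mono interior_subset)
    (fun t ht => by
      have ht' := interior_subset ht
      exact div_nonpos_of_nonpos_of_nonneg (mul_nonpos_of_nonneg_of_nonpos (Real.exp_pos _).le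
        (by linarith [(hbounds t ht').1])) (hpos t ht').le)
  have m2 := monotoneOn_of_hasDerivWithinAt_nonneg (convex_Ici (0 : ℝ))
    (fun t ht => (d2 t ht).continuousWithinAt)
    (fun t ht => (d2 t (interior_subset ht)).mono interior_subset)
    (fun t ht => by
      have ht' := interior_subset ht
      exact div_nonneg (mul_nonneg (Real.exp_pos _).le
        (by linarith [(hbounds t ht').2])) (hpos t ht').le)
  intro ε hε
  have t1 := logistic_tendsto_aux aLow ((x 0)⁻¹ - aLow⁻¹) haLow
  have t2 := logistic_tendsto_aux aUp ((x 0)⁻¹ - aUp⁻¹) haUp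
  have t1i := t1.inv₀ (inv_ne_zero haLow.ne')
  have t2i := t2.inv₀ (inv_ne_zero haUp.ne')
  rw [inv_inv] at t1i t2i
  have e1 := t1i.eventually (lt_mem_nhds (show aLow - ε < aLow by linarith))
  have e2 := t2i.eventually (gt_mem_nhds (show aUp < aUp + ε by linarith))
  have e3 := t2.eventually (lt_mem_nhds (inv_pos.2 haUp))
  obtain ⟨T, hT⟩ := Filter.eventually_atTop.1 (e1.and (e2.and e3))
  refine ⟨max T 1, lt_max_of_lt_right one_pos, fun t ht => ?_⟩
  obtain ⟨q1, q2, q3⟩ := hT t (le_trans (le_max_left _ _) ht)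
  have ht0 : (0 : ℝ) ≤ t := by linarith [le_max_right T 1]
  have hp := hpos t ht0
  have r1 := m1 (Set.mem_Ici.2 le_rfl) (Set.mem_Ici.2 ht0) ht0
  have r2 := m2 (Set.mem_Ici.2 le_rfl) (Set.mem_Ici.2 ht0) ht0
  simp only [mul_zero, Real.exp_zero, mul_one] at r1 r2
  constructor
  · have : (x t)⁻¹ ≤ aLow⁻¹ + ((x 0)⁻¹ - aLow⁻¹) * Real.exp (-(aLow * t)) := by
      rw [Real.exp_neg, ← div_eq_mul_inv]
      linarith [(le_div_iff₀ (Real.exp_pos (aLow * t))).2 r1]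
    have := inv_anti₀ (inv_pos.2 hp) this
    rw [inv_inv] at this
    linarith
  · have : aUp⁻¹ + ((x 0)⁻¹ - aUp⁻¹) * Real.exp (-(aUp * t)) ≤ (x t)⁻¹ := by
      rw [Real.exp_neg, ← div_eq_mul_inv]
      linarith [(div_le_iff₀ (Real.exp_pos (aUp * t))).2 r2]
    have := inv_anti₀ q3 this
    rw [inv_inv] at this
    linarith
end

section
/- Let g : [0, ∞) → ℝ be continuous with a̲ ≤ g(t) ≤ ā for all t ≥ 0, where 0 < a̲ ≤ ā. Let x : [0, ∞) → ℝ be differentiable with x(0) = x₀ > 0 and x'(t) = x(t)(g(t) - x(t)) for all t ≥ 0. Then lim_{t → ∞} inf_{b ∈ [a̲, ā]} |x(t) - b| = 0, i.e. the distance from x(t) to the interval B₀ = [a̲, ā] tends to zero; B₀ is a positive deterministic attracting set. -/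
open Filter

lemma logistic_aux_mono (f f' : ℝ → ℝ)
    (hf : ∀ t ∈ Set.Ici (0 : ℝ), HasDerivWithinAt f (f' t) (Set.Ici (0 : ℝ)) t)
    (hf' : ∀ t ∈ Set.Ici (0 : ℝ), 0 ≤ f' t) (t : ℝ) (ht : 0 ≤ t) : f 0 ≤ f t := by
  have hm : MonotoneOn f (Set.Ici (0 : ℝ)) := by
    refine monotoneOn_of_hasDerivWithinAt_nonneg (f' := f') (convex_Ici 0)
      (fun t ht => (hf t ht).continuousWithinAt) ?_ ?_
    · intro t ht
      exact (hf t (interior_subset ht)).mono interior_subset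
    · intro t ht
      exact hf' t (interior_subset ht)
  exact hm (Set.mem_Ici.2 le_rfl) ht ht

/-- For the logistic equation `x' = x (g(t) - x)` with `g(t) ∈ [a̲, ā]`, `0 < a̲ ≤ ā`, the
distance from any solution with positive initial value to the interval `B₀ = [a̲, ā]` tends
to zero: `B₀` is a positive deterministic attracting set. -/
theorem logistic_attracting_set (g : ℝ → ℝ) (hg : ContinuousOn g (Set.Ici (0 : ℝ)))
    (aLow aUp : ℝ) (haLow : 0 < aLow) (ha : aLow ≤ aUp)
    (hbounds : ∀ t ∈ Set.Ici (0 : ℝ), aLow ≤ g t ∧ g t ≤ aUp)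
    (x₀ : ℝ) (hx₀ : 0 < x₀) (x : ℝ → ℝ) (hx0 : x 0 = x₀)
    (hx : ∀ t ∈ Set.Ici (0 : ℝ),
      HasDerivWithinAt x (x t * (g t - x t)) (Set.Ici (0 : ℝ)) t) :
    Tendsto (fun t => ⨅ b : Set.Icc aLow aUp, |x t - (b : ℝ)|) atTop (nhds 0) := by
  have hpos : ∀ t, 0 ≤ t → 0 < x t := by
    intro t ht
    have hxc : ContinuousOn x (Set.Ici (0 : ℝ)) := fun t ht => (hx t ht).continuousWithinAt
    have hm : ∀ s : ℝ, max s 0 ∈ Set.Ici (0 : ℝ) := fun s => le_max_right s 0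
    have hc : Continuous (fun s : ℝ => g (max s 0) - x (max s 0)) :=
      (hg.sub hxc).comp_continuous (continuous_id.max continuous_const) hm
    have hH : ∀ t : ℝ, HasDerivAt (fun t => ∫ s in (0 : ℝ)..t, (g (max s 0) - x (max s 0)))
        (g (max t 0) - x (max t 0)) t := fun t => hc.integral_hasStrictDerivAt 0 t |>.hasDerivAt
    have key := logistic_aux_mono
      (fun t => x t * Real.exp (-(∫ s in (0 : ℝ)..t, (g (max s 0) - x (max s 0)))))
      (fun _ => 0) ?_ (fun _ _ => le_rfl) t ht
    · simp only [intervalIntegral.integral_same, neg_zero, Real.exp_zero, mul_one, hx0] at key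
      exact pos_of_mul_pos_left (lt_of_lt_of_le hx₀ key) (Real.exp_pos _).le
    · intro t ht
      have h := (hx t ht).mul ((hH t).neg.exp.hasDerivWithinAt (s := Set.Ici (0 : ℝ)))
      refine h.congr_deriv ?_
      rw [max_eq_left (Set.mem_Ici.1 ht)]
      simp only [Pi.neg_apply]
      ring
  have hy : ∀ c : ℝ, 0 < c → ∀ t ∈ Set.Ici (0 : ℝ),
      HasDerivWithinAt (fun t => Real.exp (c * t) * ((x t)⁻¹ - c⁻¹))
        (Real.exp (c * t) * ((c - g t) * (x t)⁻¹)) (Set.Ici (0 : ℝ)) t := by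
    intro c hc t ht
    have hp := (hpos t ht).ne'
    have h1 : HasDerivAt (fun t : ℝ => Real.exp (c * t)) (Real.exp (c * t) * (c * 1)) t :=
      ((hasDerivAt_id t).const_mul c).exp
    have h := (h1.hasDerivWithinAt (s := Set.Ici (0 : ℝ))).mul (((hx t ht).inv hp).sub_const c⁻¹)
    refine h.congr_deriv ?_
    simp only [Pi.inv_apply]
    field_simp
    ring
  have haUp : 0 < aUp := lt_of_lt_of_le haLow ha
  have hlo : ∀ t, 0 ≤ t → (x t)⁻¹ ≤ aLow⁻¹ + Real.exp (-(aLow * t)) * |x₀⁻¹ - aLow⁻¹| := by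
    intro t ht
    have h := logistic_aux_mono _ _ (fun t ht => (hy aLow haLow t ht).neg) (fun t ht => by
      have h1 := hbounds t ht
      have h2 := inv_pos.2 (hpos t ht)
      have h3 := mul_nonneg (Real.exp_pos (aLow * t)).le (mul_nonneg (sub_nonneg.2 h1.1) h2.le)
      linarith) t ht
    simp only [Pi.neg_apply, mul_zero, Real.exp_zero, one_mul, hx0] at h
    have h4 := le_abs_self (x₀⁻¹ - aLow⁻¹)
    have h5 : Real.exp (-(aLow * t)) * Real.exp (aLow * t) = 1 := by
      rw [← Real.exp_add]; simp
    have h6 := mul_le_mul_of_nonneg_left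
      (show Real.exp (aLow * t) * ((x t)⁻¹ - aLow⁻¹) ≤ |x₀⁻¹ - aLow⁻¹| by linarith)
      (Real.exp_pos (-(aLow * t))).le
    rw [← mul_assoc, h5] at h6
    linarith
  have hup : ∀ t, 0 ≤ t → aUp⁻¹ - Real.exp (-(aUp * t)) * |x₀⁻¹ - aUp⁻¹| ≤ (x t)⁻¹ := by
    intro t ht
    have h := logistic_aux_mono _ _ (hy aUp haUp) (fun t ht => by
      have h1 := hbounds t ht
      have h2 := inv_pos.2 (hpos t ht)
      exact mul_nonneg (Real.exp_pos (aUp * t)).le (mul_nonneg (sub_nonneg.2 h1.2) h2.le)) t ht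
    simp only [mul_zero, Real.exp_zero, one_mul, hx0] at h
    have h4 := neg_abs_le (x₀⁻¹ - aUp⁻¹)
    have h5 : Real.exp (-(aUp * t)) * Real.exp (aUp * t) = 1 := by
      rw [← Real.exp_add]; simp
    have h6 := mul_le_mul_of_nonneg_left
      (show -|x₀⁻¹ - aUp⁻¹| ≤ Real.exp (aUp * t) * ((x t)⁻¹ - aUp⁻¹) by linarith)
      (Real.exp_pos (-(aUp * t))).le
    rw [← mul_assoc, h5] at h6
    linarith
  have hexp : ∀ c : ℝ, 0 < c → ∀ C : ℝ,
      Tendsto (fun t : ℝ => Real.exp (-(c * t)) * C) atTop (nhds 0) := by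
    intro c hc C
    have h := (Real.tendsto_exp_neg_atTop_nhds_zero.comp
      (tendsto_id.const_mul_atTop hc)).mul_const C
    simpa [Function.comp_def] using h
  have hL := (hexp aLow haLow |x₀⁻¹ - aLow⁻¹|).const_add aLow⁻¹
  have hU := (hexp aUp haUp |x₀⁻¹ - aUp⁻¹|).const_sub aUp⁻¹
  rw [add_zero] at hL
  rw [sub_zero] at hU
  have hU0 := hU.eventually (lt_mem_nhds (inv_pos.2 haUp))
  have hL' := ((hL.inv₀ (inv_pos.2 haLow).ne').sub_const (aLow⁻¹)⁻¹).abs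
  have hU' := ((hU.inv₀ (inv_pos.2 haUp).ne').sub_const (aUp⁻¹)⁻¹).abs
  have hS := hL'.add hU'
  simp only [inv_inv, sub_self, abs_zero, add_zero] at hS
  refine squeeze_zero' (Eventually.of_forall fun t => Real.iInf_nonneg fun b => abs_nonneg _) ?_ hS
  filter_upwards [hU0, eventually_ge_atTop 0] with t h0 ht
  have hp := hpos t ht
  have e1 := inv_anti₀ (inv_pos.2 hp) (hlo t ht)
  have e2 := inv_anti₀ h0 (hup t ht)
  rw [inv_inv] at e1 e2
  have hbdd : BddBelow (Set.range fun b : Set.Icc aLow aUp => |x t - (b : ℝ)|) :=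
    ⟨0, by rintro _ ⟨b, rfl⟩; exact abs_nonneg _⟩
  have n1 := neg_abs_le ((aLow⁻¹ + Real.exp (-(aLow * t)) * |x₀⁻¹ - aLow⁻¹|)⁻¹ - aLow)
  have n2 := le_abs_self ((aUp⁻¹ - Real.exp (-(aUp * t)) * |x₀⁻¹ - aUp⁻¹|)⁻¹ - aUp)
  have n3 := abs_nonneg ((aLow⁻¹ + Real.exp (-(aLow * t)) * |x₀⁻¹ - aLow⁻¹|)⁻¹ - aLow)
  have n4 := abs_nonneg ((aUp⁻¹ - Real.exp (-(aUp * t)) * |x₀⁻¹ - aUp⁻¹|)⁻¹ - aUp)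
  rcases le_total (x t) aLow with h | h
  · refine (ciInf_le hbdd ⟨aLow, le_rfl, ha⟩).trans ?_
    rw [abs_of_nonpos (by simpa using h)]
    simp only
    linarith
  rcases le_total (x t) aUp with h' | h'
  · refine (ciInf_le hbdd ⟨x t, h, h'⟩).trans ?_
    simp only [sub_self, abs_zero]
    linarith
  · refine (ciInf_le hbdd ⟨aUp, ha, le_rfl⟩).trans ?_
    rw [abs_of_nonneg (by simpa using h')]
    simp only
    linarith
end

section
/- Let c > 0, r > 0, α ≥ 0, and let z : [0, ∞) → ℝ be continuous with (1/t) ∫₀ᵗ z(s) ds → 0 as t → ∞. Let x : [0, ∞) → ℝ be differentiable with x(0) = x₀ ∈ (0, c] and x'(t) = (r + α z(t)) x(t)(1 - x(t)/c) for all t ≥ 0. Then lim_{t → ∞} x(t) = c. -/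
open Filter intervalIntegral

lemma linear_ode_solution (g u : ℝ → ℝ) (hg : ContinuousOn g (Set.Ici (0 : ℝ)))
    (hu : ∀ t ∈ Set.Ici (0 : ℝ), HasDerivWithinAt u (g t * u t) (Set.Ici (0 : ℝ)) t)
    (t : ℝ) (ht : 0 ≤ t) : u t = u 0 * Real.exp (∫ s in (0 : ℝ)..t, g s) := by
  have hc : Continuous (fun s => g (max 0 s)) :=
    hg.comp_continuous (by fun_prop) (fun s => le_max_left 0 s)
  have hG : ∀ s, HasDerivAt (fun t => ∫ s in (0 : ℝ)..t, g (max 0 s)) (g (max 0 s)) s :=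
    fun s => hc.integral_hasStrictDerivAt 0 s |>.hasDerivAt
  have heq : (∫ s in (0 : ℝ)..t, g s) = ∫ s in (0 : ℝ)..t, g (max 0 s) := by
    apply integral_congr
    intro s hs
    rw [Set.uIcc_of_le ht] at hs
    simp [max_eq_right hs.1]
  rw [heq]
  have hd : ∀ s ∈ Set.Ici (0 : ℝ), HasDerivWithinAt
      (fun t => u t * Real.exp (-∫ s in (0 : ℝ)..t, g (max 0 s))) 0 (Set.Ici 0) s := by
    intro s hs
    have h := (hu s hs).mul ((hG s).neg.exp.hasDerivWithinAt (s := Set.Ici 0))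
    refine h.congr_deriv ?_
    rw [max_eq_right (show (0 : ℝ) ≤ s from hs)]
    simp only [Pi.neg_apply]
    ring
  have hk := constant_of_has_deriv_right_zero (a := 0) (b := t)
    (f := fun t => u t * Real.exp (-∫ s in (0 : ℝ)..t, g (max 0 s)))
    (fun s hs => ((hd s hs.1).continuousWithinAt).mono Set.Icc_subset_Ici_self)
    (fun s hs => (hd s hs.1).mono (Set.Ici_subset_Ici.2 hs.1)) t ⟨ht, le_rfl⟩
  simp only [integral_same, neg_zero, Real.exp_zero, mul_one] at hk
  rw [← hk, mul_assoc, ← Real.exp_add]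
  simp

/-- For the random logistic equation `x' = (r + α z(t)) x (1 - x/c)` with continuous
perturbation `z` whose time average tends to zero, every solution starting in `(0, c]`
converges to the carrying capacity `c`. -/
theorem logistic_perturbed_growth_rate_convergence (c r α : ℝ)
    (hc : 0 < c) (hr : 0 < r) (hα : 0 ≤ α)
    (z : ℝ → ℝ) (hz : ContinuousOn z (Set.Ici (0 : ℝ)))
    (hergodic : Tendsto (fun t => (1 / t) * ∫ s in (0 : ℝ)..t, z s) atTop (nhds 0))
    (x₀ : ℝ) (hx₀ : x₀ ∈ Set.Ioc 0 c) (x : ℝ → ℝ) (hx0 : x 0 = x₀)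
    (hx : ∀ t ∈ Set.Ici (0 : ℝ),
      HasDerivWithinAt x ((r + α * z t) * x t * (1 - x t / c)) (Set.Ici (0 : ℝ)) t) :
    Tendsto x atTop (nhds c) := by
  have hxc : ContinuousOn x (Set.Ici (0 : ℝ)) := fun t ht => (hx t ht).continuousWithinAt
  have hpos : ∀ t, 0 ≤ t → 0 < x t := by
    intro t ht
    rw [linear_ode_solution (fun t => (r + α * z t) * (1 - x t / c)) x (by fun_prop)
      (fun t ht => (hx t ht).congr_deriv (by ring)) t ht, hx0]
    exact mul_pos hx₀.1 (Real.exp_pos _)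
  have hw := linear_ode_solution (fun t => -(r + α * z t)) (fun t => c / x t - 1) (by fun_prop)
    (fun t ht => by
      have hne := (hpos t ht).ne'
      refine (((hasDerivWithinAt_const t _ c).div (hx t ht) hne).sub_const 1).congr_deriv ?_
      field_simp
      ring)
  have hint : ∀ t, 0 ≤ t → (∫ s in (0 : ℝ)..t, -(r + α * z s))
      = -(r * t + α * ∫ s in (0 : ℝ)..t, z s) := by
    intro t ht
    have hzi : IntervalIntegrable z MeasureTheory.volume 0 t :=
      (hz.mono (by rw [Set.uIcc_of_le ht]; exact Set.Icc_subset_Ici_self)).intervalIntegrable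
    rw [intervalIntegral.integral_neg, intervalIntegral.integral_add (by simp)
      (hzi.const_mul α), intervalIntegral.integral_const_mul]
    simp [mul_comm]
  have hT : Tendsto (fun t => t * (r + α * ((1 / t) * ∫ s in (0 : ℝ)..t, z s))) atTop atTop := by
    refine tendsto_id.atTop_mul_pos (C := r) hr ?_
    simpa using (hergodic.const_mul α).const_add r
  have hE : Tendsto (fun t => (c / x 0 - 1) *
      Real.exp (-(t * (r + α * ((1 / t) * ∫ s in (0 : ℝ)..t, z s))))) atTop (nhds 0) := by
    simpa using (Real.tendsto_exp_neg_atTop_nhds_zero.comp hT).const_mul (c / x 0 - 1)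
  have hL := (tendsto_const_nhds (x := c)).div (hE.const_add 1) (by norm_num)
  rw [add_zero, div_one] at hL
  refine hL.congr' ?_
  filter_upwards [eventually_gt_atTop 0] with t ht
  have h1 := hw t ht.le
  have h2 : t * (r + α * ((1 / t) * ∫ s in (0 : ℝ)..t, z s))
      = r * t + α * ∫ s in (0 : ℝ)..t, z s := by field_simp
  have hne := (hpos t ht.le).ne'
  rw [hint t ht.le] at h1
  simp only [Pi.div_apply]
  rw [h2, ← h1]
  rw [add_sub_cancel]
  field_simp
end

section
/- Let a, b, c, e > 0 and let λ, μ : [0, ∞) → ℝ be continuous with λ̲ ≤ λ(t) ≤ λ̄ and μ̲ ≤ μ(t) ≤ μ̄ for all t ≥ 0, where 0 < λ̲ ≤ λ̄ and 0 < μ̲ ≤ μ̄. Let (x, y) : [0, ∞) → ℝ² be differentiable with x(0) ≥ 0, y(0) > 0, x(t) ≥ 0 and y(t) > 0 for all t, and satisfy x'(t) = x(t)(λ(t) - a x(t) - b y(t)) and y'(t) = y(t)(μ(t) - c x(t) - e y(t)) for all t ≥ 0. If μ̲/λ̄ > c/a (equivalently μ̲ - c λ̄/a > 0), then liminf_{t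 → ∞} y(t) ≥ (μ̲ - c λ̄/a)/e; in particular the second species persists. Consequently, if in addition μ̄/λ̲ < e/b and x(0) > 0, both species coexist: for every ε > 0 there is T > 0 such that (x(t), y(t)) ∈ [(λ̲ - b μ̄/e)/a - ε, λ̄/a + ε] × [(μ̲ - c λ̄/a)/e - ε, μ̄/e + ε] for all t ≥ T. -/
open Filter

lemma aux_stay (f f' : ℝ → ℝ) (T0 k δ : ℝ) (hδ : 0 < δ)
    (hf : ∀ t ≥ T0, HasDerivWithinAt f (f' t) (Set.Ici T0) t)
    (hd : ∀ t ≥ T0, k ≤ f t → f' t ≤ -δ) :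
    ∃ T ≥ T0, ∀ t ≥ T, f t ≤ k := by
  have hcont : ∀ s ≥ T0, ∀ r, ContinuousOn f (Set.Icc s r) := by
    intro s hs r t ht
    exact (hf t (hs.le.trans ht.1)).continuousWithinAt.mono
      (fun u hu => le_trans hs.le hu.1)
  have hder : ∀ t ≥ T0, HasDerivWithinAt f (f' t) (Set.Ici t) t := fun t ht =>
    (hf t ht).mono (Set.Ici_subset_Ici.2 ht)
  have h1 : ∃ t1 ≥ T0, f t1 ≤ k := by
    by_contra! hcon
    have key : ∀ t ≥ T0, f t ≤ f T0 - δ / 2 * (t - T0) := by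
      intro t ht
      refine image_le_of_deriv_right_lt_deriv_boundary (f := f) (f' := f') (a := T0) (b := t)
        (B := fun t => f T0 - δ / 2 * (t - T0)) (B' := fun _ => -(δ / 2))
        (hcont T0 le_rfl t) (fun u hu => hder u hu.1) (by simp) ?_ ?_ ⟨ht, le_rfl⟩
      · intro u
        have := (((hasDerivAt_id u).sub_const T0).const_mul (δ / 2)).const_sub (f T0)
        simpa using this
      · intro u hu _
        have := hd u hu.1 (hcon u hu.1).le
        linarith
    have hk := hcon T0 le_rfl
    have hpos : 0 ≤ (f T0 - k) / (δ / 2) := by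
      apply div_nonneg <;> linarith
    have h2 := key (T0 + (f T0 - k) / (δ / 2)) (by linarith)
    have h3 := hcon (T0 + (f T0 - k) / (δ / 2)) (by linarith)
    have h4 : δ / 2 * (T0 + (f T0 - k) / (δ / 2) - T0) = f T0 - k := by
      field_simp
      ring
    linarith
  obtain ⟨t1, ht1, hk⟩ := h1
  refine ⟨t1, ht1, fun t ht => ?_⟩
  refine image_le_of_deriv_right_lt_deriv_boundary (f := f) (f' := f') (a := t1) (b := t)
        (B := fun _ => k) (B' := fun _ => 0)
        (hcont t1 ht1 t) (fun u hu => hder u (ht1.le.trans hu.1)) hk ?_ ?_ ⟨ht, le_rfl⟩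
  · intro u
    exact hasDerivAt_const u k
  · intro u hu h
    have := hd u (ht1.le.trans hu.1) h.ge
    linarith

lemma aux_upper (f g : ℝ → ℝ) (T0 K a ε : ℝ) (ha : 0 < a) (hK : 0 < K) (hε : 0 < ε)
    (hf : ∀ t ≥ T0, HasDerivWithinAt f (f t * g t) (Set.Ici T0) t)
    (hg : ∀ t ≥ T0, g t ≤ K - a * f t) :
    ∃ T ≥ T0, ∀ t ≥ T, f t ≤ K / a + ε := by
  have hKa : 0 < K / a := div_pos hK ha
  refine aux_stay f _ T0 (K / a + ε) ((K / a + ε) * (a * ε)) (by positivity) hf ?_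
  intro t ht hk
  have h1 := hg t ht
  have h2 : g t ≤ -(a * ε) := by
    have : a * (K / a + ε) ≤ a * f t := mul_le_mul_of_nonneg_left hk ha.le
    have h3 : a * (K / a + ε) = K + a * ε := by field_simp
    linarith
  have h4 : 0 < a * ε := by positivity
  nlinarith

lemma aux_lower (f g : ℝ → ℝ) (T0 m a ε : ℝ) (ha : 0 < a) (hε : 0 < ε)
    (hpos : ∀ t ≥ T0, 0 < f t)
    (hf : ∀ t ≥ T0, HasDerivWithinAt f (f t * g t) (Set.Ici T0) t)
    (hg : ∀ t ≥ T0, m - a * f t ≤ g t) :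
    ∃ T ≥ T0, ∀ t ≥ T, m / a - ε ≤ f t := by
  rcases le_or_gt (m / a - ε) 0 with hk | hk
  · exact ⟨T0, le_rfl, fun t ht => hk.trans (hpos t ht).le⟩
  obtain ⟨T, hT, h⟩ := aux_stay (fun t => -Real.log (f t)) (fun t => -(g t)) T0
    (-Real.log (m / a - ε)) (a * ε) (by positivity) (by
      intro t ht
      have h1 := ((hf t ht).log (hpos t ht).ne').neg
      have h2 : f t * g t / f t = g t := by
        have := (hpos t ht).ne'
        field_simp
      rw [h2] at h1
      exact h1) (by
      intro t ht hh
      have h1 : f t ≤ m / a - ε := (Real.log_le_log_iff (hpos t ht) hk).1 (by linarith)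
      have h2 := hg t ht
      have : a * f t ≤ a * (m / a - ε) := mul_le_mul_of_nonneg_left h1 ha.le
      have h3 : a * (m / a - ε) = m - a * ε := by field_simp
      linarith)
  refine ⟨T, hT, fun t ht => ?_⟩
  have := h t ht
  exact (Real.log_le_log_iff hk (hpos t (hT.le.trans ht))).1 (by simpa using this)

lemma aux_pos (f g : ℝ → ℝ) (h0 : 0 < f 0) (hnn : ∀ t ≥ 0, 0 ≤ f t)
    (hf : ∀ t ≥ 0, HasDerivWithinAt f (f t * g t) (Set.Ici 0) t)
    (hg : ContinuousOn g (Set.Ici 0)) : ∀ t ≥ 0, 0 < f t := by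
  intro t ht
  obtain ⟨M, hM⟩ := (isCompact_Icc (a := (0:ℝ)) (b := t)).exists_bound_of_continuousOn
    (hg.mono (fun u hu => hu.1))
  have hmono : MonotoneOn (fun u => f u * Real.exp (M * u)) (Set.Icc 0 t) := by
    have hE : ∀ u : ℝ, HasDerivAt (fun u => Real.exp (M * u)) (Real.exp (M * u) * M) u := by
      intro u
      simpa using ((hasDerivAt_id u).const_mul M).exp
    refine monotoneOn_of_hasDerivWithinAt_nonneg (f' := fun u =>
      f u * g u * Real.exp (M * u) + f u * (Real.exp (M * u) * M)) (convex_Icc 0 t) ?_ ?_ ?_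
    · intro u hu
      exact ((hf u hu.1).mul (hE u).hasDerivWithinAt).continuousWithinAt.mono (fun v hv => hv.1)
    · intro u hu
      have hu' := interior_subset hu
      exact ((hf u hu'.1).mul (hE u).hasDerivWithinAt).mono
        (fun v hv => (interior_subset hv).1)
    · intro u hu
      have hu' := interior_subset hu
      have h1 := hM u hu'
      rw [Real.norm_eq_abs] at h1
      have h2 := (abs_le.1 h1).1
      have h3 := mul_nonneg (mul_nonneg (hnn u hu'.1) (Real.exp_pos (M * u)).le)
        (by linarith : 0 ≤ g u + M)
      nlinarith
  have h := hmono ⟨le_rfl, ht⟩ ⟨ht, le_rfl⟩ ht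
  simp only [mul_zero, Real.exp_zero, mul_one] at h
  have h5 := h0.trans_le h
  exact (pos_iff_pos_of_mul_pos h5).2 (Real.exp_pos _)

/-- Persistence of the second species in the competitive Lotka–Volterra system: if
`μ̲ - c λ̄/a > 0` then `liminf y ≥ (μ̲ - c λ̄/a)/e`; and if moreover `μ̄/λ̲ < e/b` and
`x(0) > 0`, both species coexist, the solution eventually entering the strictly positive
absorbing box `[(λ̲ - b μ̄/e)/a - ε, λ̄/a + ε] × [(μ̲ - c λ̄/a)/e - ε, μ̄/e + ε]`. -/
theorem lotka_volterra_second_species_persists_and_coexistence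
    (a b c e lamLow lamUp muLow muUp : ℝ)
    (ha : 0 < a) (hb : 0 < b) (hc : 0 < c) (he : 0 < e)
    (hlamLow : 0 < lamLow) (hlam_le : lamLow ≤ lamUp)
    (hmuLow : 0 < muLow) (hmu_le : muLow ≤ muUp)
    (lam mu : ℝ → ℝ)
    (hlam : ContinuousOn lam (Set.Ici (0 : ℝ))) (hmu : ContinuousOn mu (Set.Ici (0 : ℝ)))
    (hlam_mem : ∀ t ∈ Set.Ici (0 : ℝ), lam t ∈ Set.Icc lamLow lamUp)
    (hmu_mem : ∀ t ∈ Set.Ici (0 : ℝ), mu t ∈ Set.Icc muLow muUp)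
    (x y : ℝ → ℝ) (hx0 : 0 ≤ x 0) (hy0 : 0 < y 0)
    (hxnonneg : ∀ t ∈ Set.Ici (0 : ℝ), 0 ≤ x t)
    (hypos : ∀ t ∈ Set.Ici (0 : ℝ), 0 < y t)
    (hx : ∀ t ∈ Set.Ici (0 : ℝ),
      HasDerivWithinAt x (x t * (lam t - a * x t - b * y t)) (Set.Ici (0 : ℝ)) t)
    (hy : ∀ t ∈ Set.Ici (0 : ℝ),
      HasDerivWithinAt y (y t * (mu t - c * x t - e * y t)) (Set.Ici (0 : ℝ)) t)
    (hpersist : muLow / lamUp > c / a) :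
    (muLow - c * lamUp / a) / e ≤ liminf y atTop ∧
    (muUp / lamLow < e / b → 0 < x 0 →
      ∀ ε > (0 : ℝ), ∃ T > (0 : ℝ), ∀ t ≥ T,
        x t ∈ Set.Icc ((lamLow - b * muUp / e) / a - ε) (lamUp / a + ε) ∧
        y t ∈ Set.Icc ((muLow - c * lamUp / a) / e - ε) (muUp / e + ε)) := by
  have hlamUp : 0 < lamUp := hlamLow.trans_le hlam_le
  have hmuUp : 0 < muUp := hmuLow.trans_le hmu_le
  -- upper bounds
  have hxU : ∀ ε > (0:ℝ), ∃ T ≥ (0:ℝ), ∀ t ≥ T, x t ≤ lamUp / a + ε := by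
    intro ε hε
    refine aux_upper x _ 0 lamUp a ε ha hlamUp hε (fun t ht => hx t ht) ?_
    intro t ht
    have h1 := (hlam_mem t ht).2
    have h2 := mul_pos hb (hypos t ht)
    linarith
  have hyU : ∀ ε > (0:ℝ), ∃ T ≥ (0:ℝ), ∀ t ≥ T, y t ≤ muUp / e + ε := by
    intro ε hε
    refine aux_upper y _ 0 muUp e ε he hmuUp hε (fun t ht => hy t ht) ?_
    intro t ht
    have h1 := (hmu_mem t ht).2
    have h2 := mul_nonneg hc.le (hxnonneg t ht)
    linarith
  have hyL : ∀ ε > (0:ℝ), ∃ T ≥ (0:ℝ), ∀ t ≥ T, (muLow - c * lamUp / a) / e - ε ≤ y t := by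
    intro ε hε
    obtain ⟨T1, hT1, h1⟩ := hxU (ε * e / (2 * c)) (by positivity)
    obtain ⟨T, hT, h⟩ := aux_lower y (fun t => mu t - c * x t - e * y t) T1
      (muLow - c * (lamUp / a + ε * e / (2 * c))) e (ε / 2) he (by positivity)
      (fun t ht => hypos t (hT1.le.trans ht))
      (fun t ht => (hy t (hT1.le.trans ht)).mono (Set.Ici_subset_Ici.2 hT1)) (by
        intro t ht
        have h2 := (hmu_mem t (hT1.le.trans ht)).1
        have h3 := mul_le_mul_of_nonneg_left (h1 t ht) hc.le
        linarith)
    refine ⟨T, hT1.le.trans hT, fun t ht => le_trans (le_of_eq ?_) (h t ht)⟩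
    field_simp
    ring
  refine ⟨?_, ?_⟩
  · have hcob : IsCoboundedUnder (· ≥ ·) atTop y := by
      obtain ⟨T, hT, h⟩ := hyU 1 one_pos
      apply IsBoundedUnder.isCoboundedUnder_ge
      exact ⟨muUp / e + 1, eventually_map.2 ((eventually_ge_atTop T).mono h)⟩
    refine le_of_forall_pos_sub_le (fun ε hε => ?_)
    obtain ⟨T, hT, h⟩ := hyL ε hε
    exact le_liminf_of_le hcob ((eventually_ge_atTop T).mono h)
  · intro _ hx0' ε hε
    have hxpos : ∀ t ≥ (0:ℝ), 0 < x t := by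
      refine aux_pos x (fun t => lam t - a * x t - b * y t) hx0' hxnonneg hx ?_
      have hxc : ContinuousOn x (Set.Ici 0) := fun t ht => (hx t ht).continuousWithinAt
      have hyc : ContinuousOn y (Set.Ici 0) := fun t ht => (hy t ht).continuousWithinAt
      exact (hlam.sub (continuousOn_const.mul hxc)).sub (continuousOn_const.mul hyc)
    have hxL : ∃ T ≥ (0:ℝ), ∀ t ≥ T, (lamLow - b * muUp / e) / a - ε ≤ x t := by
      obtain ⟨T1, hT1, h1⟩ := hyU (ε * a / (2 * b)) (by positivity)
      obtain ⟨T, hT, h⟩ := aux_lower x (fun t => lam t - a * x t - b * y t) T1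
        (lamLow - b * (muUp / e + ε * a / (2 * b))) a (ε / 2) ha (by positivity)
        (fun t ht => hxpos t (hT1.le.trans ht))
        (fun t ht => (hx t (hT1.le.trans ht)).mono (Set.Ici_subset_Ici.2 hT1)) (by
          intro t ht
          have h2 := (hlam_mem t (hT1.le.trans ht)).1
          have h3 := mul_le_mul_of_nonneg_left (h1 t ht) hb.le
          linarith)
      refine ⟨T, hT1.le.trans hT, fun t ht => le_trans (le_of_eq ?_) (h t ht)⟩
      field_simp
      ring
    obtain ⟨T1, _, h1⟩ := hxL
    obtain ⟨T2, _, h2⟩ := hxU ε hε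
    obtain ⟨T3, _, h3⟩ := hyL ε hε
    obtain ⟨T4, _, h4⟩ := hyU ε hε
    have hev : ∀ᶠ t in atTop, x t ∈ Set.Icc ((lamLow - b * muUp / e) / a - ε) (lamUp / a + ε) ∧
        y t ∈ Set.Icc ((muLow - c * lamUp / a) / e - ε) (muUp / e + ε) := by
      filter_upwards [eventually_ge_atTop T1, eventually_ge_atTop T2, eventually_ge_atTop T3,
        eventually_ge_atTop T4] with t k1 k2 k3 k4
      exact ⟨⟨h1 t k1, h2 t k2⟩, h3 t k3, h4 t k4⟩
    obtain ⟨T, hT⟩ := eventually_atTop.1 hev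
    exact ⟨max T 1, lt_max_of_lt_right one_pos, fun t ht => hT t ((le_max_left _ _).trans ht)⟩
end
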